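/- Let J be a strongly stable monomial ideal of R = K[x_1,...,x_n] of Krull dimension d = dim R/J. Then x_{n-d}^{k+1} ∈ J if and only if the Hilbert function of R/(J + (x_{n-d+1},...,x_n)) vanishes in degree k+1; consequently the reduction number of R/J equals the least k with x_{n-d}^{k+1} ∈ J. -/

import Mathlib

open MvPolynomial

theorem ss_aux {K : Type*} [Field K] {n : ℕ} (J : Ideal (MvPolynomial (Fin n) K))
    (hss : ∀ m : Fin n →₀ ℕ, monomial m (1 : K) ∈ J →
      ∀ i j : Fin n, j < i → 0 < m i →
        monomial (m - Finsupp.single i 1 + Finsupp.single j 1) (1 : K) ∈ J)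
    (p : Fin n) (N : ℕ) (hp : monomial (Finsupp.single p N) (1 : K) ∈ J) (r : ℕ) :
    ∀ m : Fin n →₀ ℕ, (∀ i, p < i → m i = 0) → m.degree = N → N ≤ m p + r →
      monomial m (1 : K) ∈ J := by
  induction r with
  | zero =>
    intro m hm hdeg hr
    have h1 : Finsupp.single p N ≤ m := by
      rw [Finsupp.single_le_iff]; omega
    obtain ⟨c, rfl⟩ := exists_add_of_le h1
    have : monomial (Finsupp.single p N + c) (1 : K)
        = monomial c 1 * monomial (Finsupp.single p N) 1 := by
      rw [monomial_mul, add_comm]; simp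
    rw [this]
    exact J.mul_mem_left _ hp
  | succ r ih =>
    intro m hm hdeg hr
    by_cases hle : N ≤ m p + r
    · exact ih m hm hdeg hle
    have hex : ∃ j, j < p ∧ 0 < m j := by
      by_contra! hcon
      have : m = Finsupp.single p (m p) := by
        ext i
        rcases lt_trichotomy i p with h | h | h
        · rw [Finsupp.single_eq_of_ne h.ne]; have := hcon i h; omega
        · subst h; simp
        · rw [Finsupp.single_eq_of_ne h.ne', hm i h]
      rw [this, Finsupp.degree_single] at hdeg
      omega
    obtain ⟨j, hj, hmj⟩ := hex
    have h1 : Finsupp.single j 1 ≤ m := by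
      rw [Finsupp.single_le_iff]; omega
    obtain ⟨c, rfl⟩ := exists_add_of_le h1
    have h2 := ih (c + Finsupp.single p 1) (by
        intro i hi
        have := hm i hi
        simp only [Finsupp.add_apply, Finsupp.single_eq_of_ne hi.ne'] at this ⊢
        omega) (by
        simp only [map_add, Finsupp.degree_single] at hdeg ⊢
        omega) (by
        simp only [Finsupp.add_apply, Finsupp.single_eq_same,
          Finsupp.single_eq_of_ne hj.ne'] at hr ⊢
        omega)
    have h3 := hss _ h2 p j hj (by simp)
    rwa [add_tsub_cancel_right, add_comm] at h3

/-- Let `J` be a strongly stable monomial ideal of `R = K[x₁,...,xₙ]` with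
`dim R/J = d`, and let `H = (x_{n-d+1}, ..., x_n)`.  Then `x_{n-d}^{k+1} ∈ J` iff the
Hilbert function of `R/(J + H)` vanishes in degree `k+1`; consequently the reduction
number of `R/J` (the least `k` such that the Hilbert function of `R/(J + H)` vanishes in
degree `k+1`) equals the least `k` with `x_{n-d}^{k+1} ∈ J`. -/
theorem strongly_stable_reduction_number
    {K : Type*} [Field K] {n d : ℕ} (hd : d < n)
    (J : Ideal (MvPolynomial (Fin n) K))
    (hmono : J = Ideal.span
      {p | ∃ m : Fin n →₀ ℕ, p = monomial m (1 : K) ∧ monomial m (1 : K) ∈ J})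
    (hss : ∀ m : Fin n →₀ ℕ, monomial m (1 : K) ∈ J →
      ∀ i j : Fin n, j < i → 0 < m i →
        monomial (m - Finsupp.single i 1 + Finsupp.single j 1) (1 : K) ∈ J)
    (hdim : ringKrullDim (MvPolynomial (Fin n) K ⧸ J) = d) :
    (∀ k : ℕ,
      monomial (Finsupp.single (⟨n - d - 1, by omega⟩ : Fin n) (k + 1)) (1 : K) ∈ J ↔
      (∀ f : MvPolynomial (Fin n) K, f.IsHomogeneous (k + 1) →
        f ∈ J ⊔ Ideal.span {g | ∃ i : Fin n, n - d ≤ (i : ℕ) ∧ g = X i})) ∧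
    sInf {k : ℕ |
        monomial (Finsupp.single (⟨n - d - 1, by omega⟩ : Fin n) (k + 1)) (1 : K) ∈ J} =
      sInf {k : ℕ | ∀ f : MvPolynomial (Fin n) K, f.IsHomogeneous (k + 1) →
        f ∈ J ⊔ Ideal.span {g | ∃ i : Fin n, n - d ≤ (i : ℕ) ∧ g = X i}} := by
  have key : ∀ k : ℕ,
      monomial (Finsupp.single (⟨n - d - 1, by omega⟩ : Fin n) (k + 1)) (1 : K) ∈ J ↔
      (∀ f : MvPolynomial (Fin n) K, f.IsHomogeneous (k + 1) →
        f ∈ J ⊔ Ideal.span {g | ∃ i : Fin n, n - d ≤ (i : ℕ) ∧ g = X i}) := by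
    intro k
    constructor
    · intro hp f hf
      rw [f.as_sum]
      refine Ideal.sum_mem _ fun m hm => ?_
      have hC : monomial m (coeff m f) = C (coeff m f) * monomial m (1 : K) := by
        rw [C_mul_monomial, mul_one]
      rw [hC]
      refine Ideal.mul_mem_left _ _ ?_
      by_cases h : ∃ i : Fin n, n - d ≤ (i : ℕ) ∧ m i ≠ 0
      · obtain ⟨i, hi, hmi⟩ := h
        refine Ideal.mem_sup_right ?_
        have hdvd : (X i : MvPolynomial (Fin n) K) ∣ monomial m (1 : K) := by
          rw [X_dvd_monomial]
          exact Or.inr hmi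
        exact Ideal.mem_of_dvd _ hdvd (Ideal.subset_span ⟨i, hi, rfl⟩)
      · push Not at h
        refine Ideal.mem_sup_left ?_
        refine ss_aux J hss _ (k + 1) hp (k + 1) m ?_ ?_ (by omega)
        · intro i hi
          apply h
          rw [Fin.lt_def] at hi
          simp only at hi
          omega
        · have := hf (mem_support_iff.mp hm)
          rwa [Finsupp.degree_eq_weight_one]
    · intro h
      have h0 := h _ (isHomogeneous_monomial (1 : K)
        (d := Finsupp.single (⟨n - d - 1, by omega⟩ : Fin n) (k + 1))
        (Finsupp.degree_single _ _))
      let φ : MvPolynomial (Fin n) K →ₐ[K] MvPolynomial (Fin n) K :=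
        aeval fun i : Fin n => if n - d ≤ (i : ℕ) then 0 else X i
      have hle : J ⊔ Ideal.span {g | ∃ i : Fin n, n - d ≤ (i : ℕ) ∧ g = X i}
          ≤ J.comap φ := by
        refine sup_le ?_ ?_
        · conv_lhs => rw [hmono]
          rw [Ideal.span_le]
          rintro _ ⟨m, rfl, hm⟩
          change φ (monomial m 1) ∈ J
          by_cases hx : ∃ i : Fin n, n - d ≤ (i : ℕ) ∧ m i ≠ 0
          · obtain ⟨i, hi, hmi⟩ := hx
            have : φ (monomial m 1) = 0 := by
              simp only [φ, aeval_monomial, Finsupp.prod]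
              rw [Finset.prod_eq_zero (Finsupp.mem_support_iff.mpr hmi), mul_zero]
              rw [if_pos hi, zero_pow hmi]
            rw [this]; exact J.zero_mem
          · push Not at hx
            have : φ (monomial m 1) = monomial m 1 := by
              rw [monomial_eq (s := m)]
              simp only [φ, map_mul, Finsupp.prod, map_prod, map_pow, aeval_X, map_one]
              congr 1
              refine Finset.prod_congr rfl fun i hi => ?_
              rw [if_neg]
              intro hc
              exact (Finsupp.mem_support_iff.mp hi) (hx i hc)
            rwa [this]
        · rw [Ideal.span_le]
          rintro _ ⟨i, hi, rfl⟩
          change φ (X i) ∈ J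
          simp only [φ, aeval_X, if_pos hi]
          exact J.zero_mem
      have h1 : φ _ ∈ J := hle h0
      have h2 : ¬ (n - d ≤ n - d - 1) := by omega
      simp only [φ, aeval_monomial] at h1
      rw [Finsupp.prod_single_index (by simp)] at h1
      simp only [h2, if_false, map_one, one_mul] at h1
      rwa [X_pow_eq_monomial] at h1
  refine ⟨key, ?_⟩
  congr 1
  ext k
  exact key k
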